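/- Let G be a finite group with |CD(G)| = |L(G)| - 2 and suppose that the Chermak-Delgado measure m_G takes exactly two distinct values on the subgroups of G. Then G is isomorphic to the cyclic group Z_{p^2} of order p^2 for some prime p. -/

import Mathlib

/-- The Chermak-Delgado measure of a subgroup `H` of `G`: `m_G(H) = |H| * |C_G(H)|`. -/
noncomputable def cdMeasure (G : Type*) [Group G] (H : Subgroup G) : ℕ :=
  Nat.card H * Nat.card (Subgroup.centralizer (H : Set G))

/-- The Chermak-Delgado lattice of `G`: the set of subgroups whose Chermak-Delgado
measure is maximal among all subgroups of `G`. -/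
def cdLattice (G : Type*) [Group G] : Set (Subgroup G) :=
  {H | ∀ K : Subgroup G, cdMeasure G K ≤ cdMeasure G H}

section ChermakDelgado

open Subgroup

variable {G : Type*} [Group G]

theorem Subgroup.centralizer_sup (H K : Subgroup G) :
    centralizer ((H ⊔ K : Subgroup G) : Set G) =
      centralizer (H : Set G) ⊓ centralizer (K : Set G) := by
  apply le_antisymm
  · exact le_inf (centralizer_le (SetLike.coe_subset_coe.mpr le_sup_left))
      (centralizer_le (SetLike.coe_subset_coe.mpr le_sup_right))
  · rw [le_centralizer_iff, sup_le_iff, le_centralizer_iff, le_centralizer_iff (H := K)]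
    exact ⟨inf_le_left, inf_le_right⟩

theorem Subgroup.centralizer_zpowers (x : G) :
    centralizer (zpowers x : Set G) = centralizer {x} := by
  rw [zpowers_eq_closure, centralizer_closure]

theorem cdMeasure_bot : cdMeasure G ⊥ = Nat.card G := by
  have h : centralizer ((⊥ : Subgroup G) : Set G) = ⊤ := by
    rw [centralizer_eq_top_iff_subset]
    exact SetLike.coe_subset_coe.mpr bot_le
  rw [cdMeasure, h]
  simp

theorem cdMeasure_top : cdMeasure G ⊤ = Nat.card G * Nat.card (center G) := by
  rw [cdMeasure, coe_top, centralizer_univ, card_top]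

variable [Finite G]

theorem Subgroup.card_mul_card_le_card_inf_mul_card {H K L : Subgroup G} (hH : H ≤ L)
    (hK : K ≤ L) :
    Nat.card H * Nat.card K ≤ Nat.card (H ⊓ K : Subgroup G) * Nat.card L := by
  have h1 := relIndex_mul_relIndex (⊥ : Subgroup G) (H ⊓ K) K bot_le inf_le_right
  have h2 := relIndex_mul_relIndex (⊥ : Subgroup G) H L bot_le hH
  rw [inf_relIndex_right] at h1
  simp only [relIndex_bot_left] at h1 h2
  have h3 : H.relIndex K ≤ H.relIndex L :=
    relIndex_le_of_le_right hK (ne_zero_of_dvd_ne_zero Nat.card_pos.ne' (relIndex_dvd_card H L))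
  rw [← h1, ← h2]
  calc _ = Nat.card H * Nat.card (H ⊓ K : Subgroup G) * H.relIndex K := by ring
    _ ≤ Nat.card H * Nat.card (H ⊓ K : Subgroup G) * H.relIndex L := by gcongr
    _ = _ := by ring

theorem cdMeasure_mul_le (H K : Subgroup G) :
    cdMeasure G H * cdMeasure G K ≤ cdMeasure G (H ⊓ K) * cdMeasure G (H ⊔ K) := by
  have h1 := card_mul_card_le_card_inf_mul_card (le_sup_left : H ≤ H ⊔ K) le_sup_right
  have h2 := card_mul_card_le_card_inf_mul_card
    (centralizer_le (SetLike.coe_subset_coe.mpr (inf_le_left : H ⊓ K ≤ H)))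
    (centralizer_le (SetLike.coe_subset_coe.mpr (inf_le_right : H ⊓ K ≤ K)))
  rw [← centralizer_sup] at h2
  unfold cdMeasure
  calc _ = (Nat.card H * Nat.card K) * (Nat.card (centralizer (H : Set G)) *
        Nat.card (centralizer (K : Set G))) := by ring
    _ ≤ _ := Nat.mul_le_mul h1 h2
    _ = _ := by ring

theorem cdMeasure_pos (H : Subgroup G) : 0 < cdMeasure G H :=
  Nat.mul_pos Nat.card_pos Nat.card_pos

theorem cdMeasure_le_map_conj (H : Subgroup G) (g : G) :
    cdMeasure G H ≤ cdMeasure G (H.map (MulAut.conj g).toMonoidHom) := by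
  have hinj : Function.Injective (MulAut.conj g).toMonoidHom := (MulAut.conj g).injective
  have h := map_centralizer_le_centralizer_image (H : Set G) (MulAut.conj g).toMonoidHom
  rw [← coe_map] at h
  have h' := card_le_of_le h
  rw [card_map_of_injective hinj] at h'
  unfold cdMeasure
  rw [card_map_of_injective hinj]
  gcongr

theorem map_conj_mem_cdLattice {H : Subgroup G} (hH : H ∈ cdLattice G) (g : G) :
    H.map (MulAut.conj g).toMonoidHom ∈ cdLattice G :=
  fun K => (hH K).trans (cdMeasure_le_map_conj H g)

theorem map_conj_mem_cdLattice_iff {H : Subgroup G} (g : G) :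
    H.map (MulAut.conj g).toMonoidHom ∈ cdLattice G ↔ H ∈ cdLattice G := by
  refine ⟨fun h => ?_, fun h => map_conj_mem_cdLattice h g⟩
  convert map_conj_mem_cdLattice h g⁻¹ using 1
  ext x
  simp [mem_map, mul_assoc]

theorem sup_mem_cdLattice {H K : Subgroup G} (hH : H ∈ cdLattice G) (hK : K ∈ cdLattice G) :
    H ⊔ K ∈ cdLattice G := by
  intro L
  have h1 := cdMeasure_mul_le H K
  have h2 := hK (H ⊓ K)
  have h3 : cdMeasure G H ≤ cdMeasure G (H ⊔ K) := by
    by_contra! hlt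
    have := cdMeasure_pos K
    nlinarith
  exact (hH L).trans h3

/-- A subgroup outside the Chermak-Delgado lattice all of whose nontrivial proper subgroups lie
in it is cyclic, since the lattice is closed under joins. -/
theorem exists_zpowers_eq_of_notMem_cdLattice {B : Subgroup G} (hB : B ∉ cdLattice G)
    (hlt : ∀ H < B, H ≠ ⊥ → H ∈ cdLattice G) : ∃ x, zpowers x = B := by
  by_contra! hne
  have hz : ∀ x ∈ B, x ≠ 1 → zpowers x ∈ cdLattice G := fun x hx hx1 =>
    hlt _ (lt_of_le_of_ne (zpowers_le.mpr hx) (hne x)) (by simpa using hx1)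
  obtain ⟨x, hx, hx1⟩ := B.bot_or_exists_ne_one.resolve_left fun h => hne 1 (by simp [h])
  obtain ⟨K, hK⟩ := (Set.toFinite {K | K ∈ cdLattice G ∧ K ≤ B}).exists_maximal
    ⟨zpowers x, hz x hx hx1, zpowers_le.mpr hx⟩
  obtain ⟨hKC, hKB⟩ := hK.prop
  refine hB (le_antisymm hKB (fun y hy => ?_) ▸ hKC)
  by_cases hy1 : y = 1
  · exact hy1 ▸ K.one_mem
  · exact hK.le_of_ge ⟨sup_mem_cdLattice hKC (hz y hy hy1), sup_le hKB (zpowers_le.mpr hy)⟩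
      le_sup_left (mem_sup_right (mem_zpowers y))

theorem card_lt_cdMeasure_zpowers_of_normal {x : G} (hx : x ≠ 1) (hn : (zpowers x).Normal) :
    Nat.card G < cdMeasure G (zpowers x) := by
  have hsub : MulAction.orbit (ConjAct G) x ⊆ (zpowers x : Set G) \ {1} := by
    rintro _ ⟨g, rfl⟩
    refine ⟨?_, fun h => hx ?_⟩
    · exact hn.conj_mem x (mem_zpowers x) (ConjAct.ofConjAct g)
    · simpa [ConjAct.smul_def] using h
  have h1 : (MulAction.orbit (ConjAct G) x).ncard < Nat.card (zpowers x) := by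
    refine (Set.ncard_le_ncard hsub).trans_lt ?_
    rw [← Nat.card_coe_set_eq]
    exact Set.ncard_sdiff_singleton_lt_of_mem (one_mem (zpowers x))
  have h2 := (MulAction.stabilizer (ConjAct G) x).card_mul_index
  rw [MulAction.index_stabilizer, ← nat_card_centralizer_nat_card_stabilizer] at h2
  have h3 : Nat.card (ConjAct G) = Nat.card G := Nat.card_congr ConjAct.ofConjAct.toEquiv
  rw [cdMeasure, centralizer_zpowers, ← h3, ← h2, mul_comm (Nat.card (zpowers x))]
  exact Nat.mul_lt_mul_of_pos_left h1 Nat.card_pos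

theorem exists_card_prime_cdMeasure_ne {p : ℕ} (hp : p.Prime) (hd : p ∣ Nat.card G) :
    ∃ x : G, Nat.card (zpowers x) = p ∧ cdMeasure G (zpowers x) ≠ Nat.card G := by
  have := Fact.mk hp
  obtain ⟨P⟩ : Nonempty (Sylow p G) := inferInstance
  have hP : Nontrivial P := by
    rw [nontrivial_iff_ne_bot]
    exact P.ne_bot_of_dvd_card hd
  have hZ : Nontrivial (center P) := P.2.center_nontrivial
  obtain ⟨z, hz⟩ := exists_prime_orderOf_dvd_card' (G := center P) p
    (((P.2.to_subgroup _).card_eq_or_dvd).resolve_left Finite.one_lt_card.ne')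
  have hx : orderOf ((z : P) : G) = p := by rw [orderOf_coe, orderOf_coe, hz]
  refine ⟨((z : P) : G), by rw [Nat.card_zpowers, hx], fun h => ?_⟩
  have hle : (P : Subgroup G) ≤ centralizer {((z : P) : G)} := fun y hy => by
    rw [mem_centralizer_singleton_iff]
    exact congrArg Subtype.val (mem_center_iff.mp z.2 ⟨y, hy⟩)
  rw [cdMeasure, centralizer_zpowers, Nat.card_zpowers, hx,
    ← (centralizer {((z : P) : G)}).card_mul_index, mul_comm] at h
  have hi := Nat.eq_of_mul_eq_mul_left Nat.card_pos h
  have hdvd := index_dvd_of_le hle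
  rw [← hi] at hdvd
  exact P.not_dvd_index hdvd

/-- If the trivial subgroup has maximal Chermak-Delgado measure in a nontrivial finite group, then
the subgroups outside the Chermak-Delgado lattice are not just one or two. -/
theorem compl_cdLattice_ne_pair [Nontrivial G] (hbot : ⊥ ∈ cdLattice G) (A B : Subgroup G) :
    (cdLattice G)ᶜ ≠ {A, B} := by
  intro hAB
  have hM : ∀ K, cdMeasure G K ≤ Nat.card G := fun K => (hbot K).trans_eq cdMeasure_bot
  have hout : ∀ H, cdMeasure G H ≠ Nat.card G → H = A ∨ H = B := fun H hH => by
    have : H ∈ (cdLattice G)ᶜ := fun hC =>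
      hH (le_antisymm (hM H) (cdMeasure_bot.symm.trans_le (hC ⊥)))
    simpa [hAB] using this
  have hnp : ∀ p, p.Prime → ¬ IsPGroup p G := fun p hp hG => by
    have := Fact.mk hp
    have := hG.center_nontrivial
    have h1 := hM ⊤
    rw [cdMeasure_top] at h1
    have h2 : 1 < Nat.card (center G) := Finite.one_lt_card
    have h3 : 0 < Nat.card G := Nat.card_pos
    nlinarith
  obtain ⟨p, hp, hpd⟩ := Nat.exists_prime_and_dvd (Finite.one_lt_card (α := G)).ne'
  obtain ⟨q, hq, hqd, hqp⟩ : ∃ q, q.Prime ∧ q ∣ Nat.card G ∧ q ≠ p := by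
    by_contra! h
    refine hnp p hp (IsPGroup.of_card (n := (Nat.card G).primeFactorsList.length) ?_)
    exact Nat.eq_prime_pow_of_unique_prime_dvd Nat.card_pos.ne' (fun hd hdv => h _ hd hdv)
  obtain ⟨x, hxp, hx⟩ := exists_card_prime_cdMeasure_ne hp hpd
  obtain ⟨y, hyq, hy⟩ := exists_card_prime_cdMeasure_ne hq hqd
  have hx1 : x ≠ 1 := by
    rintro rfl
    exact hp.one_lt.ne (by simpa using hxp)
  have hxC : zpowers x ∉ cdLattice G := by
    change zpowers x ∈ (cdLattice G)ᶜ
    rw [hAB]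
    exact hout _ hx
  refine (hM (zpowers x)).not_gt (card_lt_cdMeasure_zpowers_of_normal hx1 ?_)
  rw [normal_iff_map_conj_eq]
  intro g
  have hc : Nat.card ((zpowers x).map (MulAut.conj g).toMonoidHom) = p := by
    rw [card_map_of_injective (MulAut.conj g).injective, hxp]
  have hg : (zpowers x).map (MulAut.conj g).toMonoidHom ∈ (cdLattice G)ᶜ :=
    fun h => hxC ((map_conj_mem_cdLattice_iff g).mp h)
  rw [hAB] at hg
  change (zpowers x).map (MulAut.conj g).toMonoidHom = zpowers x
  generalize (zpowers x).map (MulAut.conj g).toMonoidHom = L at hc hg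
  have hxy := hout _ hx
  have hyx := hout _ hy
  have hne : zpowers y ≠ zpowers x := fun h => hqp (by rw [← hyq, h, hxp])
  have hne' : zpowers y ≠ L := fun h => hqp (by rw [← hyq, h, hc])
  simp only [Set.mem_insert_iff, Set.mem_singleton_iff] at hg
  grind

/-- A nontrivial subgroup that together with the trivial one makes up the complement of the
Chermak-Delgado lattice has measure larger than that of the trivial subgroup. -/
theorem card_lt_cdMeasure_of_compl_cdLattice_eq {B : Subgroup G} (hB : B ≠ ⊥)
    (hC : (cdLattice G)ᶜ = {⊥, B}) : Nat.card G < cdMeasure G B := by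
  have hin : ∀ H, H ∉ cdLattice G ↔ H = ⊥ ∨ H = B := fun H => by
    rw [← Set.mem_compl_iff, hC]
    simp
  obtain ⟨x, rfl⟩ := exists_zpowers_eq_of_notMem_cdLattice ((hin B).mpr (.inr rfl))
    fun H hH hH' => by
      by_contra h
      exact ((hin H).mp h).elim hH' hH.ne
  refine card_lt_cdMeasure_zpowers_of_normal (by simpa using hB) ?_
  rw [normal_iff_map_conj_eq]
  intro g
  have hg := mt (map_conj_mem_cdLattice_iff g).mp ((hin (zpowers x)).mpr (.inr rfl))
  refine ((hin _).mp hg).resolve_left fun h => hB ?_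
  rwa [map_eq_bot_iff_of_injective _ (MulAut.conj g).injective] at h

theorem cdLattice_nonempty : (cdLattice G).Nonempty := by
  obtain ⟨M, hM⟩ := Finite.exists_max (cdMeasure G)
  exact ⟨M, hM⟩

end ChermakDelgado

/-- If a finite group `G` satisfies `|CD(G)| = |L(G)| - 2` and the Chermak-Delgado
measure takes exactly two distinct values on the subgroups of `G`, then
`G ≅ ℤ_{p²}` for some prime `p`. -/
theorem cd_eq_sub_two_two_values (G : Type*) [Group G] [Finite G]
    (h : Nat.card (cdLattice G) = Nat.card (Subgroup G) - 2)
    (h2 : Nat.card (Set.range (cdMeasure G)) = 2) :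
    ∃ p : ℕ, p.Prime ∧ Nonempty (G ≃* Multiplicative (ZMod (p ^ 2))) := by
  exfalso
  obtain ⟨M, hM⟩ := cdLattice_nonempty (G := G)
  rw [Nat.card_coe_set_eq] at h h2
  have hpos : 0 < (cdLattice G).ncard := (Set.ncard_pos).mpr ⟨M, hM⟩
  have hcompl : (cdLattice G)ᶜ.ncard = 2 := by
    have := Set.ncard_add_ncard_compl (cdLattice G)
    omega
  obtain ⟨A, B, hne, hAB⟩ := Set.ncard_eq_two.mp hcompl
  obtain ⟨a, b, -, hab⟩ := Set.ncard_eq_two.mp h2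
  have hval : ∀ H, cdMeasure G H = a ∨ cdMeasure G H = b := fun H => by
    have : cdMeasure G H ∈ Set.range (cdMeasure G) := ⟨H, rfl⟩
    simpa [hab] using this
  have hout : ∀ H ∈ (cdLattice G)ᶜ, cdMeasure G H ≠ cdMeasure G M := fun H hH he =>
    hH fun K => he ▸ hM K
  have hA := hout A (by simp [hAB])
  have hB := hout B (by simp [hAB])
  have hmAB : cdMeasure G A = cdMeasure G B := by
    have := hval A
    have := hval B
    have := hval M
    omega
  by_cases hbot : ⊥ ∈ cdLattice G
  · have : Nontrivial G := by
      rw [← Subgroup.nontrivial_iff]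
      exact ⟨A, B, hne⟩
    exact compl_cdLattice_ne_pair hbot A B hAB
  · have hbot' : (⊥ : Subgroup G) ∈ (cdLattice G)ᶜ := hbot
    rw [hAB] at hbot'
    rcases hbot' with rfl | rfl
    · have := card_lt_cdMeasure_of_compl_cdLattice_eq hne.symm hAB
      rw [← hmAB, cdMeasure_bot] at this
      exact this.false
    · have := card_lt_cdMeasure_of_compl_cdLattice_eq hne (hAB.trans (Set.pair_comm _ _))
      rw [hmAB, cdMeasure_bot] at this
      exact this.false
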